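/- (Lorentz Λ(φ) generalization of the decomposition.) For j = 1, 2 let Φⱼ : [0,∞) → [0,∞) be concave, non-decreasing, with Φⱼ(0) = 0 (equivalently, Φⱼ is the primitive vanishing at 0 of a non-negative non-increasing function φⱼ). Suppose f : Ω₁ × Ω₂ → ℝ is measurable and for every pair of measurable sets E₁ ⊆ Ω₁, E₂ ⊆ Ω₂ of finite measure one has ∫_{E₁×E₂} |f| d(μ₁×μ₂) ≤ Φ₁(μ₁(E₁)) + Φ₂(μ₂(E₂)). Then there exist measurable f₁, f₂ with f = f₁ + f₂ (μ₁×μ₂)-almost everywhere such that for every pair of measurable sets E₁ ⊆ Ω₁, E₂ ⊆ Ω₂ of finite measure: ∫_{E₁×E₂} |f₁| d(μ₁×μ₂) ≤ 2 Φ₁(μ₁(E₁)) and ∫_{E₁×E₂} |f₂| d(μ₁×μ₂) ≤ 2 Φ₂(μ₂(E₂)). -/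

import Mathlib

open MeasureTheory ENNReal NNReal

lemma submod (Φ : ℝ → ℝ) (hc : ConcaveOn ℝ (Set.Ici 0) Φ) (x p q : ℝ) (hx : 0 ≤ x) (hp : 0 ≤ p) (hq : 0 ≤ q) :
    Φ (x + p + q) + Φ x ≤ Φ (x + p) + Φ (x + q) := by
  rcases eq_or_lt_of_le (add_nonneg hp hq) with h | h
  · have : p = 0 := by linarith
    have : q = 0 := by linarith
    subst_vars; simp
  · have h1 := hc.2 hx (show x + p + q ∈ Set.Ici (0:ℝ) by simp; positivity) (show 0 ≤ q / (p + q) by positivity) (show 0 ≤ p / (p + q) by positivity)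
      (by field_simp; ring)
    have h2 := hc.2 hx (show x + p + q ∈ Set.Ici (0:ℝ) by simp; positivity) (show 0 ≤ p / (p + q) by positivity) (show 0 ≤ q / (p + q) by positivity)
      (by field_simp)
    simp only [smul_eq_mul] at h1 h2
    rw [show q / (p + q) * x + p / (p + q) * (x + p + q) = x + p by field_simp; ring] at h1
    rw [show p / (p + q) * x + q / (p + q) * (x + p + q) = x + q by field_simp; ring] at h2
    have h3 : q / (p + q) + p / (p + q) = 1 := by field_simp; ring
    have : q / (p + q) * Φ x + p / (p + q) * Φ (x + p + q) + (p / (p + q) * Φ x + q / (p + q) * Φ (x + p + q))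
       = (q / (p + q) + p / (p + q)) * (Φ (x + p + q) + Φ x) := by ring
    rw [h3] at this
    linarith

lemma submodSet {α : Type*} [MeasurableSpace α] (μ : Measure α) [IsFiniteMeasure μ] (Φ : ℝ → ℝ) (hc : ConcaveOn ℝ (Set.Ici 0) Φ)
    (hn : ∀ x ∈ Set.Ici (0 : ℝ), 0 ≤ Φ x) (A B : Set α) (hB : MeasurableSet B) :
    ENNReal.ofReal (Φ (μ (A ∪ B)).toReal) + ENNReal.ofReal (Φ (μ (A ∩ B)).toReal) ≤
    ENNReal.ofReal (Φ (μ A).toReal) + ENNReal.ofReal (Φ (μ B).toReal) := by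
  rw [← ENNReal.ofReal_add (hn _ ENNReal.toReal_nonneg) (hn _ ENNReal.toReal_nonneg),
    ← ENNReal.ofReal_add (hn _ ENNReal.toReal_nonneg) (hn _ ENNReal.toReal_nonneg)]
  apply ENNReal.ofReal_le_ofReal
  have h1 : μ.real (A ∩ B) ≤ μ.real A := measureReal_mono Set.inter_subset_left
  have h2 : μ.real (A ∩ B) ≤ μ.real B := measureReal_mono Set.inter_subset_right
  have h3 := measureReal_union_add_inter (μ := μ) (s := A) hB
  have := submod Φ hc (μ.real (A ∩ B)) (μ.real A - μ.real (A ∩ B)) (μ.real B - μ.real (A ∩ B))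
    (by positivity) (by linarith) (by linarith)
  rw [show μ.real (A ∩ B) + (μ.real A - μ.real (A ∩ B)) + (μ.real B - μ.real (A ∩ B)) = μ.real (A ∪ B) by linarith] at this
  simpa [Measure.real] using this

lemma lovasz {α : Type*} [MeasurableSpace α] (F : Set α → ℝ≥0∞) (hmono : Monotone F)
    (hsub : ∀ A B, MeasurableSet A → MeasurableSet B → F (A ∪ B) + F (A ∩ B) ≤ F A + F B)
    (h0 : F ∅ = 0) (hfin : F Set.univ ≠ ∞) {ι : Type*} (s : Finset ι) (E : ι → Set α)
    (hE : ∀ i, MeasurableSet (E i)) (l : ι → ℝ) (hl : ∀ i, 0 ≤ l i) :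
    ∫⁻ t in Set.Ioi (0:ℝ), F {x | t < ∑ i ∈ s, l i * (E i).indicator 1 x}
      ≤ ∑ i ∈ s, ENNReal.ofReal (l i) * F (E i) := by
  classical
  induction s using Finset.induction_on with
  | empty =>
    simp only [Finset.sum_empty, nonpos_iff_eq_zero]
    rw [setLIntegral_congr_fun (g := fun _ => 0) measurableSet_Ioi]
    · simp
    · intro t ht
      have : {x : α | t < 0} = ∅ := by
        ext x; simpa using le_of_lt ht
      simp only [this, h0]
  | insert j s hj ih =>
    rw [Finset.sum_insert hj]
    set V : α → ℝ := fun x => ∑ i ∈ s, l i * (E i).indicator 1 x with hV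
    set G : ℝ → Set α := fun t => {x | t < V x} with hG
    have hVm : Measurable V := by
      refine Finset.measurable_sum _ fun i _ => ?_
      exact (measurable_one.indicator (hE i)).const_mul _
    have hGm : ∀ t, MeasurableSet (G t) := fun t => measurableSet_lt measurable_const hVm
    have hGanti : ∀ t t', t ≤ t' → G t' ⊆ G t := fun t t' h x hx => lt_of_le_of_lt h hx
    have hV0 : ∀ x, 0 ≤ V x := fun x => Finset.sum_nonneg fun i _ =>
      mul_nonneg (hl i) (Set.indicator_nonneg (by simp) _)
    have hVb : ∀ x, V x ≤ ∑ i ∈ s, l i := fun x => Finset.sum_le_sum fun i _ => by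
      refine mul_le_of_le_one_right (hl i) ?_
      by_cases h : x ∈ E i <;> simp [h]
    have hset : ∀ t, {x | t < ∑ i ∈ insert j s, l i * (E i).indicator 1 x}
        = G t ∪ (E j ∩ G (t - l j)) := by
      intro t
      ext x
      simp only [Finset.sum_insert hj, Set.mem_ofPred_eq, hG, Set.mem_union, Set.mem_inter_iff]
      change t < l j * _ + V x ↔ _
      by_cases h : x ∈ E j
      · have := hl j
        simp only [h, Set.indicator_of_mem, Pi.one_apply, mul_one, true_and]
        constructor
        · intro h; right; linarith
        · rintro (h | h) <;> linarith
      · simp [h]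
    simp_rw [hset]
    have hpt : ∀ t, F (G t ∪ (E j ∩ G (t - l j))) + F (E j ∩ G t) ≤ F (G t) + F (E j ∩ G (t - l j)) := by
      intro t
      have := hsub (G t) (E j ∩ G (t - l j)) (hGm _) ((hE j).inter (hGm _))
      rwa [show G t ∩ (E j ∩ G (t - l j)) = E j ∩ G t from by
        have := hGanti (t - l j) t (by linarith [hl j])
        ext x; constructor
        · rintro ⟨a, b, c⟩; exact ⟨b, a⟩
        · rintro ⟨a, b⟩; exact ⟨b, a, this b⟩] at this
    have hm1 : Measurable fun t => F (E j ∩ G t) :=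
      Antitone.measurable fun t t' h => hmono (Set.inter_subset_inter_right _ (hGanti _ _ h))
    have hm2 : Measurable fun t => F (G t) :=
      Antitone.measurable fun t t' h => hmono (hGanti _ _ h)
    have hI : ∫⁻ t in Set.Ioi (0:ℝ), F (E j ∩ G t) ≠ ∞ := by
      have : ∫⁻ t in Set.Ioi (0:ℝ), F (E j ∩ G t) ≤ ∫⁻ t in Set.Ioi (0:ℝ),
          (Set.Ioc 0 (∑ i ∈ s, l i)).indicator (fun _ => F Set.univ) t := by
        refine setLIntegral_mono (measurable_const.indicator measurableSet_Ioc) fun t ht => ?_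
        by_cases h : t ≤ ∑ i ∈ s, l i
        · rw [Set.indicator_of_mem (by exact ⟨ht, h⟩)]
          exact hmono (Set.subset_univ _)
        · have : G t = ∅ := by
            ext x; simp only [hG, Set.mem_ofPred_eq, Set.mem_empty_iff_false, iff_false]
            have := hVb x
            linarith
          simp [this, h0]
      refine ne_top_of_le_ne_top ?_ (this.trans (setLIntegral_le_lintegral _ _))
      rw [lintegral_indicator measurableSet_Ioc]
      simp only [lintegral_const]
      exact ENNReal.mul_ne_top hfin (by simp)
    have hshift : ∫⁻ t in Set.Ioi (0:ℝ), F (E j ∩ G (t - l j))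
        ≤ ENNReal.ofReal (l j) * F (E j) + ∫⁻ t in Set.Ioi (0:ℝ), F (E j ∩ G t) := by
      have e1 : ∫⁻ t in Set.Ioi (0:ℝ), F (E j ∩ G (t - l j)) = ∫⁻ t in Set.Ioi (- l j), F (E j ∩ G t) := by
        rw [← lintegral_indicator measurableSet_Ioi, ← lintegral_indicator measurableSet_Ioi,
          ← lintegral_sub_right_eq_self ((Set.Ioi (- l j)).indicator _) (l j)]
        congr 1; ext t
        by_cases h : 0 < t
        · rw [Set.indicator_of_mem (by exact h), Set.indicator_of_mem (by simp [h])]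
        · rw [Set.indicator_of_notMem (by exact h), Set.indicator_of_notMem (by simpa using h)]
      have e2 : Set.Ioi (- l j) = Set.Ioc (- l j) 0 ∪ Set.Ioi 0 := by
        rw [Set.Ioc_union_Ioi_eq_Ioi]
        linarith [hl j]
      rw [e1, e2]
      refine (lintegral_union_le _ _ _).trans ?_
      gcongr
      refine (lintegral_mono (g := fun _ => F (E j)) fun t => hmono Set.inter_subset_left).trans ?_
      simp [mul_comm]
    have key : (∫⁻ t in Set.Ioi (0:ℝ), F (G t ∪ (E j ∩ G (t - l j)))) + ∫⁻ t in Set.Ioi (0:ℝ), F (E j ∩ G t)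
        ≤ (ENNReal.ofReal (l j) * F (E j) + ∫⁻ t in Set.Ioi (0:ℝ), F (G t)) + ∫⁻ t in Set.Ioi (0:ℝ), F (E j ∩ G t) := by
      rw [← lintegral_add_right _ hm1]
      refine (lintegral_mono hpt).trans ?_
      rw [lintegral_add_left hm2]
      refine (add_le_add_right hshift _).trans ?_
      apply le_of_eq; ring
    exact ((ENNReal.add_le_add_iff_right hI).1 key).trans (by gcongr)

lemma weakLim {X : Type*} [MeasurableSpace X] (ρ : Measure X) [IsFiniteMeasure ρ] {α : Type*}
    (U : Ultrafilter α) (h : α → X → ℝ) (hm : ∀ a, Measurable (h a))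
    (h0 : ∀ a x, 0 ≤ h a x) (h1 : ∀ a x, h a x ≤ 1) :
    ∃ g : X → ℝ, Measurable g ∧ (∀ x, 0 ≤ g x) ∧ (∀ x, g x ≤ 1) ∧
      ∀ φ : X → ℝ, Measurable φ → (∃ C, ∀ x, |φ x| ≤ C) →
        Filter.Tendsto (fun a => ∫ x, h a x * φ x ∂ρ) U (nhds (∫ x, g x * φ x ∂ρ)) := by
  have hmem : ∀ φ : X → ℝ, Measurable φ → (∃ C, ∀ x, |φ x| ≤ C) → MemLp φ 2 ρ := by
    rintro φ hφ ⟨C, hC⟩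
    exact MemLp.of_bound hφ.aestronglyMeasurable C (Filter.Eventually.of_forall hC)
  have hb : ∀ a x, |h a x| ≤ 1 := fun a x => by rw [abs_of_nonneg (h0 a x)]; exact h1 a x
  have hh : ∀ a, MemLp (h a) 2 ρ := fun a => hmem _ (hm a) ⟨1, hb a⟩
  let H : α → Lp ℝ 2 ρ := fun a => (hh a).toLp
  let R : ℝ := (measureUnivNNReal ρ : ℝ) ^ (2 : ℝ≥0∞).toReal⁻¹ * 1
  have hR : ∀ a, ‖H a‖ ≤ R := fun a => by
    refine Lp.norm_le_of_ae_bound zero_le_one ?_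
    filter_upwards [(hh a).coeFn_toLp] with x hx
    rw [hx]; exact hb a x
  let L : α → WeakDual ℝ (Lp ℝ 2 ρ) := fun a =>
    StrongDual.toWeakDual (InnerProductSpace.toDual ℝ (Lp ℝ 2 ρ) (H a))
  obtain ⟨l, -, hl⟩ := (WeakDual.isCompact_closedBall (𝕜 := ℝ) (E := Lp ℝ 2 ρ) 0 R).ultrafilter_le_nhds'
    (U.map L) (Filter.Eventually.of_forall (f := (U : Filter α)) (fun a => by
      show (InnerProductSpace.toDual ℝ (Lp ℝ 2 ρ) (H a)) ∈ Metric.closedBall 0 R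
      simpa using hR a))
  let g₀ : Lp ℝ 2 ρ := (InnerProductSpace.toDual ℝ (Lp ℝ 2 ρ)).symm (WeakDual.toStrongDual l)
  have hlim0 : ∀ φ : Lp ℝ 2 ρ, Filter.Tendsto (fun a => inner ℝ (H a) φ) U (nhds (inner ℝ g₀ φ)) := by
    intro φ
    have e : inner ℝ g₀ φ = l φ := by
      simp [g₀]
    rw [e]
    exact ((WeakDual.eval_continuous φ).tendsto l).comp (show Filter.Tendsto L U (nhds l) from hl)
  have hlim : ∀ φ : X → ℝ, Measurable φ → (∃ C, ∀ x, |φ x| ≤ C) →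
      Filter.Tendsto (fun a => ∫ x, h a x * φ x ∂ρ) U (nhds (∫ x, g₀ x * φ x ∂ρ)) := by
    intro φ hφ hC
    have := hlim0 (hmem φ hφ hC).toLp
    simp only [L2.inner_def] at this
    convert this using 2
    · rename_i a
      refine integral_congr_ae ?_
      filter_upwards [(hh a).coeFn_toLp, (hmem φ hφ hC).coeFn_toLp] with x e1 e2
      simp [H, e1, e2, mul_comm]
    · refine integral_congr_ae ?_
      filter_upwards [(hmem φ hφ hC).coeFn_toLp] with x e2
      simp [e2, mul_comm]
  have hset : ∀ s, MeasurableSet s → Filter.Tendsto (fun a => ∫ x in s, h a x ∂ρ) U (nhds (∫ x in s, g₀ x ∂ρ)) := by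
    intro s hs
    have := hlim (s.indicator 1) (measurable_one.indicator hs) ⟨1, fun x => by
      by_cases hx : x ∈ s <;> simp [hx]⟩
    convert this using 2
    · rename_i a
      rw [← integral_indicator hs]; congr 1; ext x
      by_cases hx : x ∈ s <;> simp [hx]
    · rw [← integral_indicator hs]; congr 1; ext x
      by_cases hx : x ∈ s <;> simp [hx]
  have hgi : Integrable g₀ ρ := (Lp.memLp g₀).integrable (by norm_num)
  have p0 : 0 ≤ᵐ[ρ] g₀ := by
    refine ae_nonneg_of_forall_setIntegral_nonneg hgi fun s hs _ => ?_
    exact ge_of_tendsto' (hset s hs) fun a => integral_nonneg (h0 a)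
  have p1 : g₀ ≤ᵐ[ρ] fun _ => (1:ℝ) := by
    refine ae_le_of_forall_setIntegral_le hgi (integrable_const _) fun s hs _ => ?_
    refine le_of_tendsto' (hset s hs) fun a => ?_
    exact integral_mono ((hh a).integrable (by norm_num)).integrableOn (integrable_const _) (h1 a)
  refine ⟨fun x => max 0 (min 1 (g₀ x)), ?_, fun x => le_max_left _ _, fun x => ?_, ?_⟩
  · exact measurable_const.max (measurable_const.min (Lp.stronglyMeasurable g₀).measurable)
  · simp
  · intro φ hφ hC
    convert hlim φ hφ hC using 2
    refine integral_congr_ae ?_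
    filter_upwards [p0, p1] with x a b
    simp only [Pi.zero_apply] at a
    rw [min_eq_right b, max_eq_right a]

lemma lim_bound {X : Type*} [MeasurableSpace X] (ρ : Measure X) [IsFiniteMeasure ρ] {α : Type*}
    (U : Ultrafilter α) (h : α → X → ℝ) (g : X → ℝ) (hm : ∀ a, Measurable (h a)) (gm : Measurable g)
    (h0 : ∀ a x, 0 ≤ h a x) (h1 : ∀ a x, h a x ≤ 1) (g0 : ∀ x, 0 ≤ g x) (g1 : ∀ x, g x ≤ 1)
    (hlim : ∀ φ : X → ℝ, Measurable φ → (∃ C, ∀ x, |φ x| ≤ C) →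
        Filter.Tendsto (fun a => ∫ x, h a x * φ x ∂ρ) U (nhds (∫ x, g x * φ x ∂ρ)))
    (v : X → ℝ≥0) (hv : Measurable v) (c : ℝ≥0∞) (ε : α → ℝ≥0∞) (hε : Filter.Tendsto ε U (nhds 0))
    (hc : ∀ᶠ a in U, ∫⁻ x, ENNReal.ofReal (h a x) * v x ∂ρ ≤ c + ε a) :
    ∫⁻ x, ENNReal.ofReal (g x) * v x ∂ρ ≤ c := by
  let w : ℕ → X → ℝ≥0 := fun k => {x | v x ≤ k}.indicator v
  have wm : ∀ k, Measurable (w k) := fun k => hv.indicator (measurableSet_le hv measurable_const)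
  have wle : ∀ k x, w k x ≤ k := fun k x => by
    by_cases hx : v x ≤ k
    · simp [w, hx]
    · simp [w, hx]
  have wv : ∀ k x, w k x ≤ v x := fun k x => Set.indicator_le_self _ _ _
  have wb : ∀ k, ∃ C, ∀ x, |(w k x : ℝ)| ≤ C := fun k => ⟨k, fun x => by
    rw [abs_of_nonneg (by positivity)]; exact_mod_cast wle k x⟩
  have conv : ∀ (u : X → ℝ) (um : Measurable u) (u0 : ∀ x, 0 ≤ u x) (u1 : ∀ x, u x ≤ 1) (k : ℕ),
      ∫⁻ x, ENNReal.ofReal (u x) * w k x ∂ρ = ENNReal.ofReal (∫ x, u x * w k x ∂ρ) := by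
    intro u um u0 u1 k
    rw [ofReal_integral_eq_lintegral_ofReal]
    · refine lintegral_congr fun x => ?_
      rw [ENNReal.ofReal_mul (u0 x), ENNReal.ofReal_coe_nnreal]
    · refine Integrable.of_bound (um.mul (wm k).coe_nnreal_real).aestronglyMeasurable k
        (Filter.Eventually.of_forall fun x => ?_)
      rw [Real.norm_of_nonneg (mul_nonneg (u0 x) (by positivity))]
      calc u x * w k x ≤ 1 * k := mul_le_mul (u1 x) (by exact_mod_cast wle k x) (by positivity) zero_le_one
        _ = k := one_mul _
    · exact Filter.Eventually.of_forall fun x => mul_nonneg (u0 x) (by positivity)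
  have hk : ∀ k, ∫⁻ x, ENNReal.ofReal (g x) * w k x ∂ρ ≤ c := by
    intro k
    have t1 := (ENNReal.continuous_ofReal.tendsto _).comp (hlim (fun x => w k x) (wm k).coe_nnreal_real (wb k))
    rw [← conv g gm g0 g1 k] at t1
    have t2 : Filter.Tendsto (fun a => c + ε a) U (nhds (c + 0)) := tendsto_const_nhds.add hε
    rw [add_zero] at t2
    refine le_of_tendsto_of_tendsto t1 t2 ?_
    filter_upwards [hc] with a ha
    refine le_trans ?_ ha
    simp only [Function.comp]
    rw [← conv (h a) (hm a) (h0 a) (h1 a) k]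
    exact lintegral_mono fun x => by gcongr; exact wv k x
  have hsup : ∀ x, ENNReal.ofReal (g x) * v x = ⨆ k, ENNReal.ofReal (g x) * w k x := by
    intro x
    refine le_antisymm ?_ (iSup_le fun k => by gcongr; exact wv k x)
    obtain ⟨k, hk⟩ := exists_nat_ge (v x)
    refine le_iSup_of_le k ?_
    simp [w, hk]
  simp_rw [hsup]
  rw [lintegral_iSup]
  · exact iSup_le hk
  · exact fun k => gm.ennreal_ofReal.mul (wm k).coe_nnreal_ennreal
  · intro k k' hkk x
    have : w k x ≤ w k' x := by
      by_cases hx : v x ≤ k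
      · have : v x ≤ k' := hx.trans (by exact_mod_cast hkk)
        simp [w, hx, this]
      · simp [w, hx]
    simp only
    gcongr

lemma select {X : Type*} [MeasurableSpace X] (ρ : Measure X) [IsFiniteMeasure ρ] {P : Type*}
    (v : P → X → ℝ≥0) (hv : ∀ p, Measurable (v p)) (c₁ c₂ : P → ℝ≥0∞)
    (H : ∀ (s : Finset P) (ε : ℝ), 0 < ε → ∃ h : X → ℝ, Measurable h ∧ (∀ x, 0 ≤ h x) ∧ (∀ x, h x ≤ 1) ∧
      ∀ p ∈ s, ∫⁻ x, ENNReal.ofReal (h x) * v p x ∂ρ ≤ c₁ p + ENNReal.ofReal ε ∧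
        ∫⁻ x, ENNReal.ofReal (1 - h x) * v p x ∂ρ ≤ c₂ p + ENNReal.ofReal ε) :
    ∃ h : X → ℝ, Measurable h ∧ (∀ x, 0 ≤ h x) ∧ (∀ x, h x ≤ 1) ∧
      ∀ p, ∫⁻ x, ENNReal.ofReal (h x) * v p x ∂ρ ≤ c₁ p ∧
        ∫⁻ x, ENNReal.ofReal (1 - h x) * v p x ∂ρ ≤ c₂ p := by
  classical
  choose h hm h0 h1 hc using fun a : Finset P × ℕ => H a.1 (1 / ((a.2 : ℝ) + 1)) (by positivity)
  let U : Ultrafilter (Finset P × ℕ) := Ultrafilter.of Filter.atTop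
  have hU : (U : Filter (Finset P × ℕ)) ≤ Filter.atTop := Ultrafilter.of_le _
  obtain ⟨g, gm, g0, g1, hlim⟩ := weakLim ρ U h hm h0 h1
  have hε : Filter.Tendsto (fun a : Finset P × ℕ => ENNReal.ofReal (1 / ((a.2 : ℝ) + 1))) U (nhds 0) := by
    have : Filter.Tendsto (fun a : Finset P × ℕ => (1 / ((a.2 : ℝ) + 1))) Filter.atTop (nhds 0) := by
      rw [← Filter.prod_atTop_atTop_eq]
      exact (tendsto_one_div_add_atTop_nhds_zero_nat (𝕜 := ℝ)).comp Filter.tendsto_snd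
    have := (ENNReal.continuous_ofReal.tendsto _).comp (this.mono_left hU)
    simpa [Function.comp_def] using this
  have hev : ∀ p, ∀ᶠ a in (U : Filter (Finset P × ℕ)), p ∈ a.1 := by
    intro p
    apply hU
    filter_upwards [Filter.eventually_ge_atTop (({p} : Finset P), 0)] with a ha
    exact ha.1 (by simp)
  refine ⟨g, gm, g0, g1, fun p => ⟨?_, ?_⟩⟩
  · refine lim_bound ρ U h g hm gm h0 h1 g0 g1 hlim (v p) (hv p) _ _ hε ?_
    filter_upwards [hev p] with a ha using (hc a p ha).1
  · refine lim_bound ρ U (fun a x => 1 - h a x) (fun x => 1 - g x) (fun a => measurable_const.sub (hm a))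
      (measurable_const.sub gm) (fun a x => by linarith [h1 a x]) (fun a x => by linarith [h0 a x])
      (fun x => by linarith [g1 x]) (fun x => by linarith [g0 x]) ?_ (v p) (hv p) _ _ hε ?_
    · intro φ hφ hC
      obtain ⟨C, hC'⟩ := id hC
      have iφ : Integrable φ ρ := Integrable.of_bound hφ.aestronglyMeasurable C (Filter.Eventually.of_forall hC')
      have key : ∀ u : X → ℝ, Measurable u → (∀ x, 0 ≤ u x) → (∀ x, u x ≤ 1) →
          ∫ x, (1 - u x) * φ x ∂ρ = ∫ x, φ x ∂ρ - ∫ x, u x * φ x ∂ρ := by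
        intro u um u0 u1
        rw [← integral_sub iφ]
        · congr 1; ext x; ring
        · exact iφ.bdd_mul (c := 1) um.aestronglyMeasurable (Filter.Eventually.of_forall fun x => by
            rw [Real.norm_of_nonneg (u0 x)]; exact u1 x)
      rw [key g gm g0 g1]
      simp_rw [fun a => key (h a) (hm a) (h0 a) (h1 a)]
      exact tendsto_const_nhds.sub (hlim φ hφ hC)
    · filter_upwards [hev p] with a ha using (hc a p ha).2

lemma sepLemma {V ι : Type*} [AddCommGroup V] [Module ℝ V] [Fintype ι] (H : Set V) (hH : H.Nonempty)
    (T : ι → V → ℝ) (hT : ∀ i, ConvexOn ℝ H (T i)) (hHc : Convex ℝ H) (c : ι → ℝ)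
    (hl : ∀ l : ι → ℝ, (∀ i, 0 ≤ l i) → ∃ h ∈ H, ∑ i, l i * T i h ≤ ∑ i, l i * c i) (ε : ℝ) (hε : 0 < ε) :
    ∃ h ∈ H, ∀ i, T i h < c i + ε := by
  classical
  by_contra hcon
  let C : Set (ι → ℝ) := {y | ∃ h ∈ H, ∀ i, T i h < y i}
  have hopen : IsOpen C := by
    have : C = ⋃ h ∈ H, ⋂ i, {y : ι → ℝ | T i h < y i} := by
      ext y; simp [C]
    rw [this]
    exact isOpen_biUnion fun h _ => isOpen_iInter_of_finite fun i =>
      isOpen_lt continuous_const (continuous_apply i)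
  have hconv : Convex ℝ C := by
    rintro y ⟨h, hh, hy⟩ z ⟨k, hk, hz⟩ a b ha hb hab
    refine ⟨a • h + b • k, hHc hh hk ha hb hab, fun i => ?_⟩
    refine ((hT i).2 hh hk ha hb hab).trans_lt ?_
    simp only [smul_eq_mul, Pi.add_apply, Pi.smul_apply]
    rcases eq_or_lt_of_le ha with rfl | ha'
    · have : b = 1 := by linarith
      subst this; simpa using hz i
    · nlinarith [mul_lt_mul_of_pos_left (hy i) ha', mul_le_mul_of_nonneg_left (hz i).le hb]
  obtain ⟨F, hF⟩ := geometric_hahn_banach_point_open (x := fun i => c i + ε) hconv hopen hcon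
  let l : ι → ℝ := fun i => F (Pi.single i 1)
  have hFl : ∀ y, F y = ∑ i, l i * y i := by
    intro y
    conv_lhs => rw [← Finset.univ_sum_single y]
    rw [map_sum]
    refine Finset.sum_congr rfl fun i _ => ?_
    have : Pi.single i (y i) = y i • (Pi.single i (1:ℝ) : ι → ℝ) := by
      rw [← Pi.single_smul]; simp
    rw [this, map_smul, smul_eq_mul, mul_comm]
  obtain ⟨h₀, hh₀⟩ := hH
  have lnn : ∀ i, 0 ≤ l i := by
    intro i
    by_contra hneg
    push Not at hneg
    let y₀ : ι → ℝ := fun j => T j h₀ + 1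
    have : ∀ t : ℝ, 0 ≤ t → F (fun i => c i + ε) < F y₀ + t * l i := by
      intro t ht
      have := hF (y₀ + t • Pi.single i 1) ⟨h₀, hh₀, fun j => by
        have : (0:ℝ) ≤ (Pi.single i 1 : ι → ℝ) j := by
          by_cases hj : j = i
          · subst hj; simp
          · simp [hj]
        simp only [y₀, Pi.add_apply, Pi.smul_apply, smul_eq_mul]
        nlinarith [mul_nonneg ht this]⟩
      simpa [l] using this
    have h1 := this 0 le_rfl
    have h2 := this ((F y₀ - F (fun i => c i + ε)) / (- l i)) (div_nonneg (by linarith) (by linarith))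
    have : (F y₀ - F (fun i => c i + ε)) / (- l i) * l i = -(F y₀ - F (fun i => c i + ε)) := by
      rw [div_mul_eq_mul_div, div_neg, mul_div_cancel_right₀ _ hneg.ne]
    linarith
  obtain ⟨h, hh, hle⟩ := hl l lnn
  have := hF (fun i => T i h + ε / 2) ⟨h, hh, fun i => by linarith⟩
  simp only [hFl, mul_add, Finset.sum_add_distrib, ← Finset.sum_mul] at this
  have : 0 ≤ ∑ i, l i := Finset.sum_nonneg fun i _ => lnn i
  nlinarith

lemma oneSide {Ω ι : Type*} [MeasurableSpace Ω] (μ : Measure Ω) (Φ : ℝ → ℝ)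
    (hc : ConcaveOn ℝ (Set.Ici 0) Φ) (hmono : MonotoneOn Φ (Set.Ici 0))
    (hn : ∀ x ∈ Set.Ici (0 : ℝ), 0 ≤ Φ x) (h0 : Φ 0 = 0) (s : Finset ι) (E : ι → Set Ω)
    (hE : ∀ i, MeasurableSet (E i)) (hf : ∀ i, μ (E i) < ∞) (l : ι → ℝ) (hl : ∀ i, 0 ≤ l i) :
    (∀ t, MeasurableSet {x | t < ∑ i ∈ s, l i * (E i).indicator 1 x}) ∧
    (∀ t, 0 < t → μ {x | t < ∑ i ∈ s, l i * (E i).indicator 1 x} < ∞) ∧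
    Measurable (fun x => ∑ i ∈ s, l i * (E i).indicator (1 : Ω → ℝ) x) ∧
    (∀ x, 0 ≤ ∑ i ∈ s, l i * (E i).indicator (1 : Ω → ℝ) x) ∧
    ∃ G : ℝ → ℝ≥0∞, Measurable G ∧
      (∀ t, 0 < t → ENNReal.ofReal (Φ (μ {x | t < ∑ i ∈ s, l i * (E i).indicator 1 x}).toReal) ≤ G t) ∧
      ∫⁻ t in Set.Ioi 0, G t ≤ ∑ i ∈ s, ENNReal.ofReal (l i) * ENNReal.ofReal (Φ (μ (E i)).toReal) := by
  have hUm : Measurable (fun x => ∑ i ∈ s, l i * (E i).indicator (1 : Ω → ℝ) x) :=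
    Finset.measurable_sum _ fun i _ => (measurable_one.indicator (hE i)).const_mul _
  have hm : ∀ t, MeasurableSet {x | t < ∑ i ∈ s, l i * (E i).indicator 1 x} :=
    fun t => measurableSet_lt measurable_const hUm
  let S : Set Ω := ⋃ i ∈ s, E i
  have hSm : MeasurableSet S := Finset.measurableSet_biUnion _ fun i _ => hE i
  have hSf : μ S < ∞ := (measure_biUnion_lt_top s.finite_toSet fun i _ => hf i)
  have hsubS : ∀ t, 0 < t → {x | t < ∑ i ∈ s, l i * (E i).indicator 1 x} ⊆ S := by
    intro t ht x hx
    by_contra hxS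
    have : ∑ i ∈ s, l i * (E i).indicator (1 : Ω → ℝ) x = 0 := by
      refine Finset.sum_eq_zero fun i hi => ?_
      have : x ∉ E i := fun h => hxS (Set.mem_biUnion (t := E) hi h)
      simp [this]
    simp only [Set.mem_ofPred_eq, this] at hx
    exact absurd hx (not_lt.2 ht.le)
  have : IsFiniteMeasure (μ.restrict S) := ⟨by simpa using hSf⟩
  let F : Set Ω → ℝ≥0∞ := fun A => ENNReal.ofReal (Φ ((μ.restrict S) A).toReal)
  have hF : ∀ A, A ⊆ S → F A = ENNReal.ofReal (Φ (μ A).toReal) := fun A hA => by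
    simp only [F, Measure.restrict_apply' hSm, Set.inter_eq_left.2 hA]
  have hFmono : Monotone F := fun A B hAB => ENNReal.ofReal_le_ofReal
    (hmono ENNReal.toReal_nonneg ENNReal.toReal_nonneg
      (ENNReal.toReal_mono (measure_ne_top _ _) (measure_mono hAB)))
  refine ⟨hm, fun t ht => (measure_mono (hsubS t ht)).trans_lt hSf, hUm, fun x => Finset.sum_nonneg fun i _ =>
    mul_nonneg (hl i) (Set.indicator_nonneg (by simp) _),
    fun t => F {x | t < ∑ i ∈ s, l i * (E i).indicator 1 x}, ?_, ?_, ?_⟩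
  · exact Antitone.measurable fun t t' h => hFmono fun x hx => lt_of_le_of_lt h hx
  · intro t ht
    simp only
    rw [hF _ (hsubS t ht)]
  · refine (lovasz F hFmono (fun A B _ hB => submodSet _ Φ hc hn A B hB) (by simp [F, h0])
      (by simp [F]) s E hE l hl).trans_eq ?_
    refine Finset.sum_congr rfl fun i hi => ?_
    rw [hF _ (fun x hx => Set.mem_biUnion (t := E) hi hx)]

lemma dualBound {Ω₁ Ω₂ : Type*} [MeasurableSpace Ω₁] [MeasurableSpace Ω₂]
    (μ₁ : Measure Ω₁) (μ₂ : Measure Ω₂)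
    (Φ₁ Φ₂ : ℝ → ℝ)
    (hΦ₁concave : ConcaveOn ℝ (Set.Ici 0) Φ₁) (hΦ₂concave : ConcaveOn ℝ (Set.Ici 0) Φ₂)
    (hΦ₁mono : MonotoneOn Φ₁ (Set.Ici 0)) (hΦ₂mono : MonotoneOn Φ₂ (Set.Ici 0))
    (hΦ₁nonneg : ∀ x ∈ Set.Ici (0 : ℝ), 0 ≤ Φ₁ x)
    (hΦ₂nonneg : ∀ x ∈ Set.Ici (0 : ℝ), 0 ≤ Φ₂ x)
    (hΦ₁zero : Φ₁ 0 = 0) (hΦ₂zero : Φ₂ 0 = 0)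
    (ν : Measure (Ω₁ × Ω₂))
    (hbound : ∀ E₁ E₂ : Set _, MeasurableSet E₁ → MeasurableSet E₂ →
      μ₁ E₁ < ∞ → μ₂ E₂ < ∞ → ν (E₁ ×ˢ E₂)
        ≤ ENNReal.ofReal (Φ₁ (μ₁ E₁).toReal) + ENNReal.ofReal (Φ₂ (μ₂ E₂).toReal))
    {ι : Type*} (s : Finset ι) (E₁ : ι → Set Ω₁) (E₂ : ι → Set Ω₂)
    (hE₁ : ∀ i, MeasurableSet (E₁ i)) (hE₂ : ∀ i, MeasurableSet (E₂ i))
    (hf₁ : ∀ i, μ₁ (E₁ i) < ∞) (hf₂ : ∀ i, μ₂ (E₂ i) < ∞)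
    (l₁ l₂ : ι → ℝ) (hl₁ : ∀ i, 0 ≤ l₁ i) (hl₂ : ∀ i, 0 ≤ l₂ i) :
    ∫⁻ x, ENNReal.ofReal (min (∑ i ∈ s, l₁ i * (E₁ i).indicator 1 x.1) (∑ i ∈ s, l₂ i * (E₂ i).indicator 1 x.2)) ∂ν
     ≤ ∑ i ∈ s, ENNReal.ofReal (l₁ i) * ENNReal.ofReal (Φ₁ (μ₁ (E₁ i)).toReal)
      + ∑ i ∈ s, ENNReal.ofReal (l₂ i) * ENNReal.ofReal (Φ₂ (μ₂ (E₂ i)).toReal) := by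
  obtain ⟨m1, f1, U1, n1, G1, gm1, gb1, gi1⟩ :=
    oneSide μ₁ Φ₁ hΦ₁concave hΦ₁mono hΦ₁nonneg hΦ₁zero s E₁ hE₁ hf₁ l₁ hl₁
  obtain ⟨m2, f2, U2, n2, G2, gm2, gb2, gi2⟩ :=
    oneSide μ₂ Φ₂ hΦ₂concave hΦ₂mono hΦ₂nonneg hΦ₂zero s E₂ hE₂ hf₂ l₂ hl₂
  rw [lintegral_eq_lintegral_meas_lt ν (Filter.Eventually.of_forall fun x => le_min (n1 x.1) (n2 x.2))
    ((U1.comp measurable_fst).min (U2.comp measurable_snd)).aemeasurable]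
  refine le_trans ?_ (add_le_add gi1 gi2)
  rw [← lintegral_add_left gm1]
  refine setLIntegral_mono (gm1.add gm2) fun t ht => ?_
  refine le_trans ?_ (add_le_add (gb1 t ht) (gb2 t ht))
  refine le_trans (le_of_eq ?_) (hbound _ _ (m1 t) (m2 t) (f1 t ht) (f2 t ht))
  congr 1
  ext x
  simp

lemma finiteStep {Ω₁ Ω₂ : Type*} [MeasurableSpace Ω₁] [MeasurableSpace Ω₂]
    (μ₁ : Measure Ω₁) (μ₂ : Measure Ω₂) [SigmaFinite μ₁] [SigmaFinite μ₂]
    (Φ₁ Φ₂ : ℝ → ℝ)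
    (hΦ₁concave : ConcaveOn ℝ (Set.Ici 0) Φ₁) (hΦ₂concave : ConcaveOn ℝ (Set.Ici 0) Φ₂)
    (hΦ₁mono : MonotoneOn Φ₁ (Set.Ici 0)) (hΦ₂mono : MonotoneOn Φ₂ (Set.Ici 0))
    (hΦ₁nonneg : ∀ x ∈ Set.Ici (0 : ℝ), 0 ≤ Φ₁ x)
    (hΦ₂nonneg : ∀ x ∈ Set.Ici (0 : ℝ), 0 ≤ Φ₂ x)
    (hΦ₁zero : Φ₁ 0 = 0) (hΦ₂zero : Φ₂ 0 = 0)
    (f : Ω₁ × Ω₂ → ℝ) (hf : Measurable f)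
    (hbound : ∀ E₁ E₂ : Set _, MeasurableSet E₁ → MeasurableSet E₂ →
      μ₁ E₁ < ∞ → μ₂ E₂ < ∞ →
      ∫⁻ x in E₁ ×ˢ E₂, ‖f x‖₊ ∂(μ₁.prod μ₂)
        ≤ ENNReal.ofReal (Φ₁ (μ₁ E₁).toReal) + ENNReal.ofReal (Φ₂ (μ₂ E₂).toReal))
    {ι : Type*} [Fintype ι] (E₁ : ι → Set Ω₁) (E₂ : ι → Set Ω₂)
    (hE₁ : ∀ i, MeasurableSet (E₁ i)) (hE₂ : ∀ i, MeasurableSet (E₂ i))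
    (hf₁ : ∀ i, μ₁ (E₁ i) < ∞) (hf₂ : ∀ i, μ₂ (E₂ i) < ∞) (ε : ℝ) (hε : 0 < ε) :
    ∃ h : Ω₁ × Ω₂ → ℝ, Measurable h ∧ (∀ x, 0 ≤ h x) ∧ (∀ x, h x ≤ 1) ∧
      ∀ i, ∫⁻ x in E₁ i ×ˢ E₂ i, ENNReal.ofReal (h x) * ‖f x‖₊ ∂(μ₁.prod μ₂)
          ≤ ENNReal.ofReal (Φ₁ (μ₁ (E₁ i)).toReal) + ENNReal.ofReal ε ∧
        ∫⁻ x in E₁ i ×ˢ E₂ i, ENNReal.ofReal (1 - h x) * ‖f x‖₊ ∂(μ₁.prod μ₂)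
          ≤ ENNReal.ofReal (Φ₂ (μ₂ (E₂ i)).toReal) + ENNReal.ofReal ε := by
  have hfint : ∀ i, IntegrableOn f (E₁ i ×ˢ E₂ i) (μ₁.prod μ₂) := fun i =>
    ⟨hf.aestronglyMeasurable, (hbound _ _ (hE₁ i) (hE₂ i) (hf₁ i) (hf₂ i)).trans_lt
      (ENNReal.add_lt_top.2 ⟨ofReal_lt_top, ofReal_lt_top⟩)⟩
  have hui : ∀ (u : Ω₁ × Ω₂ → ℝ), Measurable u → (∀ x, 0 ≤ u x) → (∀ x, u x ≤ 1) → ∀ i,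
      IntegrableOn (fun x => u x * |f x|) (E₁ i ×ˢ E₂ i) (μ₁.prod μ₂) := by
    intro u um u0 u1 i
    exact (hfint i).abs.bdd_mul (c := 1) um.aestronglyMeasurable (Filter.Eventually.of_forall fun x => by
            rw [Real.norm_of_nonneg (u0 x)]; exact u1 x)
  have hconv : ∀ (u : Ω₁ × Ω₂ → ℝ), Measurable u → (∀ x, 0 ≤ u x) → (∀ x, u x ≤ 1) → ∀ i,
      ∫⁻ x in E₁ i ×ˢ E₂ i, ENNReal.ofReal (u x) * ‖f x‖₊ ∂(μ₁.prod μ₂)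
        = ENNReal.ofReal (∫ x in E₁ i ×ˢ E₂ i, u x * |f x| ∂(μ₁.prod μ₂)) := by
    intro u um u0 u1 i
    rw [ofReal_integral_eq_lintegral_ofReal (hui u um u0 u1 i)
      (Filter.Eventually.of_forall fun x => mul_nonneg (u0 x) (abs_nonneg _))]
    refine lintegral_congr fun x => ?_
    rw [ENNReal.ofReal_mul (u0 x), ← Real.norm_eq_abs, ofReal_norm, enorm_eq_nnnorm]
  let H : Set (Ω₁ × Ω₂ → ℝ) := {h | Measurable h ∧ (∀ x, 0 ≤ h x) ∧ (∀ x, h x ≤ 1)}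
  have hHc : Convex ℝ H := by
    rintro h ⟨hm, h0, h1⟩ k ⟨km, k0, k1⟩ a b ha hb hab
    refine ⟨(hm.const_smul a).add (km.const_smul b), fun x => ?_, fun x => ?_⟩
    · simp only [Pi.add_apply, Pi.smul_apply, smul_eq_mul]
      have := h0 x; have := k0 x; positivity
    · simp only [Pi.add_apply, Pi.smul_apply, smul_eq_mul]
      nlinarith [mul_le_mul_of_nonneg_left (h1 x) ha, mul_le_mul_of_nonneg_left (k1 x) hb]
  let T : ι ⊕ ι → (Ω₁ × Ω₂ → ℝ) → ℝ := Sum.elim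
    (fun i h => ∫ x in E₁ i ×ˢ E₂ i, h x * |f x| ∂(μ₁.prod μ₂))
    (fun i h => ∫ x in E₁ i ×ˢ E₂ i, (1 - h x) * |f x| ∂(μ₁.prod μ₂))
  let c : ι ⊕ ι → ℝ := Sum.elim (fun i => Φ₁ (μ₁ (E₁ i)).toReal) (fun i => Φ₂ (μ₂ (E₂ i)).toReal)
  have hc0 : ∀ i, 0 ≤ c i := by
    rintro (i | i)
    · exact hΦ₁nonneg _ ENNReal.toReal_nonneg
    · exact hΦ₂nonneg _ ENNReal.toReal_nonneg
  have hcm : ∀ h ∈ H, (fun x => 1 - h x) ∈ H := fun h hh =>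
    ⟨measurable_const.sub hh.1, fun x => by linarith [hh.2.2 x], fun x => by linarith [hh.2.1 x]⟩
  have hT : ∀ i, ConvexOn ℝ H (T i) := by
    rintro (i | i)
    · refine ⟨hHc, fun h hh k hk a b ha hb hab => le_of_eq ?_⟩
      simp only [T, Sum.elim_inl, smul_eq_mul]
      rw [← integral_const_mul, ← integral_const_mul, ← integral_add]
      · congr 1; ext x; simp only [Pi.add_apply, Pi.smul_apply, smul_eq_mul]; ring
      · exact (hui h hh.1 hh.2.1 hh.2.2 i).const_mul a
      · exact (hui k hk.1 hk.2.1 hk.2.2 i).const_mul b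
    · refine ⟨hHc, fun h hh k hk a b ha hb hab => le_of_eq ?_⟩
      simp only [T, Sum.elim_inr, smul_eq_mul]
      rw [← integral_const_mul, ← integral_const_mul, ← integral_add]
      · congr 1; ext x; simp only [Pi.add_apply, Pi.smul_apply, smul_eq_mul]
        have : b = 1 - a := by linarith
        subst this; ring
      · have hh := hcm h hh
        exact (hui _ hh.1 hh.2.1 hh.2.2 i).const_mul a
      · have hk := hcm k hk
        exact (hui _ hk.1 hk.2.1 hk.2.2 i).const_mul b
  have key : ∀ l : ι ⊕ ι → ℝ, (∀ i, 0 ≤ l i) → ∃ h ∈ H, ∑ i, l i * T i h ≤ ∑ i, l i * c i := by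
    intro l hl
    obtain ⟨-, -, Um, U0, -⟩ := oneSide μ₁ Φ₁ hΦ₁concave hΦ₁mono hΦ₁nonneg hΦ₁zero Finset.univ E₁ hE₁ hf₁
      (fun i => l (Sum.inl i)) (fun i => hl _)
    obtain ⟨-, -, Wm, W0, -⟩ := oneSide μ₂ Φ₂ hΦ₂concave hΦ₂mono hΦ₂nonneg hΦ₂zero Finset.univ E₂ hE₂ hf₂
      (fun i => l (Sum.inr i)) (fun i => hl _)
    have D := dualBound μ₁ μ₂ Φ₁ Φ₂ hΦ₁concave hΦ₂concave hΦ₁mono hΦ₂mono hΦ₁nonneg hΦ₂nonneg hΦ₁zero hΦ₂zero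
      ((μ₁.prod μ₂).withDensity fun x => (‖f x‖₊ : ℝ≥0∞)) (by
        intro A B hA hB fA fB
        rw [withDensity_apply _ (hA.prod hB)]
        exact hbound A B hA hB fA fB) Finset.univ E₁ E₂ hE₁ hE₂ hf₁ hf₂
      (fun i => l (Sum.inl i)) (fun i => l (Sum.inr i)) (fun i => hl _) (fun i => hl _)
    set U : Ω₁ → ℝ := fun x => ∑ i, l (Sum.inl i) * (E₁ i).indicator 1 x with hU
    set W : Ω₂ → ℝ := fun x => ∑ i, l (Sum.inr i) * (E₂ i).indicator 1 x with hW
    change ∫⁻ x : Ω₁ × Ω₂, ENNReal.ofReal (min (U x.1) (W x.2)) ∂_ ≤ _ at D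
    have hUWm : MeasurableSet {x : Ω₁ × Ω₂ | U x.1 ≤ W x.2} :=
      measurableSet_le (Um.comp measurable_fst) (Wm.comp measurable_snd)
    let h : Ω₁ × Ω₂ → ℝ := {x : Ω₁ × Ω₂ | U x.1 ≤ W x.2}.indicator 1
    have hh : h ∈ H := by
      refine ⟨measurable_one.indicator hUWm, fun x => Set.indicator_nonneg (by simp) _, fun x => ?_⟩
      by_cases hx : U x.1 ≤ W x.2 <;> simp [h, hx]
    have hh' := hcm h hh
    have T0 : ∀ i, 0 ≤ T i h := by
      rintro (i | i)
      · exact integral_nonneg fun x => mul_nonneg (hh.2.1 x) (abs_nonneg _)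
      · exact integral_nonneg fun x => mul_nonneg (hh'.2.1 x) (abs_nonneg _)
    refine ⟨h, hh, ?_⟩
    rw [← ENNReal.ofReal_le_ofReal_iff (Finset.sum_nonneg fun i _ => mul_nonneg (hl i) (hc0 i)),
      ENNReal.ofReal_sum_of_nonneg (fun i _ => mul_nonneg (hl i) (hc0 i)),
      ENNReal.ofReal_sum_of_nonneg (fun i _ => mul_nonneg (hl i) (T0 i))]
    have om : ∀ i (q : ℝ), ENNReal.ofReal (l i * q) = ENNReal.ofReal (l i) * ENNReal.ofReal q :=
      fun i q => ENNReal.ofReal_mul (hl i)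
    have mm : Measurable fun x : Ω₁ × Ω₂ => ENNReal.ofReal (min (U x.1) (W x.2)) :=
      ((Um.comp measurable_fst).min (Wm.comp measurable_snd)).ennreal_ofReal
    simp only [om, Fintype.sum_sum_type]
    refine le_trans ?_ D
    rw [lintegral_withDensity_eq_lintegral_mul _ hf.nnnorm.coe_nnreal_ennreal mm]
    have one : ∀ (u : Ω₁ × Ω₂ → ℝ) (_ : u ∈ H) (a : ι → ℝ) (_ : ∀ i, 0 ≤ a i) (V : Ω₁ × Ω₂ → ℝ)
        (_ : ∀ x, ∑ i, a i * (E₁ i ×ˢ E₂ i).indicator (1 : Ω₁ × Ω₂ → ℝ) x ≤ V x),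
        ∑ i, ENNReal.ofReal (a i) * ENNReal.ofReal (∫ x in E₁ i ×ˢ E₂ i, u x * |f x| ∂(μ₁.prod μ₂))
          ≤ ∫⁻ x, ‖f x‖₊ * ENNReal.ofReal (u x * V x) ∂(μ₁.prod μ₂) := by
      intro u hu a ha V hV
      have humeas : Measurable fun x => ENNReal.ofReal (u x) * (‖f x‖₊ : ℝ≥0∞) :=
        hu.1.ennreal_ofReal.mul hf.nnnorm.coe_nnreal_ennreal
      simp_rw [fun i => (hconv u hu.1 hu.2.1 hu.2.2 i).symm,
        fun i => (lintegral_indicator ((hE₁ i).prod (hE₂ i)) (μ := μ₁.prod μ₂)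
          (fun x => ENNReal.ofReal (u x) * (‖f x‖₊ : ℝ≥0∞))).symm,
        fun i => (lintegral_const_mul (μ := μ₁.prod μ₂) (ENNReal.ofReal (a i))
          (humeas.indicator ((hE₁ i).prod (hE₂ i)))).symm]
      rw [← lintegral_finsetSum _ fun i _ => (humeas.indicator ((hE₁ i).prod (hE₂ i))).const_mul _]
      refine lintegral_mono fun x => ?_
      have : ∑ i, ENNReal.ofReal (a i) * (E₁ i ×ˢ E₂ i).indicator
          (fun x => ENNReal.ofReal (u x) * (‖f x‖₊ : ℝ≥0∞)) x
          = ‖f x‖₊ * (ENNReal.ofReal (u x) * ENNReal.ofReal (∑ i, a i * (E₁ i ×ˢ E₂ i).indicator (1 : Ω₁ × Ω₂ → ℝ) x)) := by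
        rw [ENNReal.ofReal_sum_of_nonneg (fun i _ => mul_nonneg (ha i) (Set.indicator_nonneg (by simp) _)),
          Finset.mul_sum, Finset.mul_sum]
        refine Finset.sum_congr rfl fun i _ => ?_
        by_cases hx : x ∈ E₁ i ×ˢ E₂ i
        · simp only [Set.indicator_of_mem hx, Pi.one_apply, mul_one]; ring
        · simp [Set.indicator_of_notMem hx]
      rw [this, ENNReal.ofReal_mul (hu.2.1 x)]
      gcongr
      exact hV x
    refine (add_le_add
      (one h hh (fun i => l (Sum.inl i)) (fun i => hl _) (fun x => U x.1) fun x => ?_)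
      (one _ hh' (fun i => l (Sum.inr i)) (fun i => hl _) (fun x => W x.2) fun x => ?_)).trans ?_
    · refine Finset.sum_le_sum fun i _ => mul_le_mul_of_nonneg_left ?_ (hl _)
      by_cases h1 : x.1 ∈ E₁ i <;> by_cases h2 : x.2 ∈ E₂ i <;> simp [Set.indicator, Set.mem_prod, h1, h2]
    · refine Finset.sum_le_sum fun i _ => mul_le_mul_of_nonneg_left ?_ (hl _)
      by_cases h1 : x.1 ∈ E₁ i <;> by_cases h2 : x.2 ∈ E₂ i <;> simp [Set.indicator, Set.mem_prod, h1, h2]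
    · rw [← lintegral_add_left]
      · refine lintegral_mono fun x => ?_
        simp only [Pi.mul_apply]
        rw [← mul_add]
        gcongr
        by_cases hx : U x.1 ≤ W x.2
        · simp [h, hx]
        · simp [h, hx, (not_le.1 hx).le]
      · exact hf.nnnorm.coe_nnreal_ennreal.mul (hh.1.mul (Um.comp measurable_fst)).ennreal_ofReal
  obtain ⟨h, hh, hlt⟩ := sepLemma H ⟨fun _ => 0, measurable_const, by simp, by simp⟩ T hT hHc c key ε hε
  · have hh' := hcm h hh
    refine ⟨h, hh.1, hh.2.1, hh.2.2, fun i => ⟨?_, ?_⟩⟩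
    · rw [hconv h hh.1 hh.2.1 hh.2.2 i, ← ENNReal.ofReal_add (hΦ₁nonneg _ ENNReal.toReal_nonneg) hε.le]
      exact ENNReal.ofReal_le_ofReal (hlt (Sum.inl i)).le
    · rw [hconv _ hh'.1 hh'.2.1 hh'.2.2 i, ← ENNReal.ofReal_add (hΦ₂nonneg _ ENNReal.toReal_nonneg) hε.le]
      exact ENNReal.ofReal_le_ofReal (hlt (Sum.inr i)).le

/-- Lorentz `Λ(φ)` generalization of the decomposition: for concave non-decreasing
`Φⱼ : [0,∞) → [0,∞)` with `Φⱼ(0) = 0`, if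
`∫_{E₁×E₂} |f| ≤ Φ₁(μ₁(E₁)) + Φ₂(μ₂(E₂))` for all measurable sets of finite measure,
then `f = f₁ + f₂` a.e. with `∫_{E₁×E₂} |f₁| ≤ 2 Φ₁(μ₁(E₁))` and
`∫_{E₁×E₂} |f₂| ≤ 2 Φ₂(μ₂(E₂))` for all such sets. -/
theorem lorentz_lambda_decomposition
    {Ω₁ Ω₂ : Type*} [MeasurableSpace Ω₁] [MeasurableSpace Ω₂]
    (μ₁ : Measure Ω₁) (μ₂ : Measure Ω₂) [SigmaFinite μ₁] [SigmaFinite μ₂]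
    (Φ₁ Φ₂ : ℝ → ℝ)
    (hΦ₁concave : ConcaveOn ℝ (Set.Ici 0) Φ₁) (hΦ₂concave : ConcaveOn ℝ (Set.Ici 0) Φ₂)
    (hΦ₁mono : MonotoneOn Φ₁ (Set.Ici 0)) (hΦ₂mono : MonotoneOn Φ₂ (Set.Ici 0))
    (hΦ₁nonneg : ∀ x ∈ Set.Ici (0 : ℝ), 0 ≤ Φ₁ x)
    (hΦ₂nonneg : ∀ x ∈ Set.Ici (0 : ℝ), 0 ≤ Φ₂ x)
    (hΦ₁zero : Φ₁ 0 = 0) (hΦ₂zero : Φ₂ 0 = 0)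
    (f : Ω₁ × Ω₂ → ℝ) (hf : Measurable f)
    (hbound : ∀ E₁ E₂ : Set _, MeasurableSet E₁ → MeasurableSet E₂ →
      μ₁ E₁ < ∞ → μ₂ E₂ < ∞ →
      ∫⁻ x in E₁ ×ˢ E₂, ‖f x‖₊ ∂(μ₁.prod μ₂)
        ≤ ENNReal.ofReal (Φ₁ (μ₁ E₁).toReal) + ENNReal.ofReal (Φ₂ (μ₂ E₂).toReal)) :
    ∃ f₁ f₂ : Ω₁ × Ω₂ → ℝ, Measurable f₁ ∧ Measurable f₂ ∧
      f =ᵐ[μ₁.prod μ₂] f₁ + f₂ ∧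
      (∀ E₁ E₂ : Set _, MeasurableSet E₁ → MeasurableSet E₂ →
        μ₁ E₁ < ∞ → μ₂ E₂ < ∞ →
        ∫⁻ x in E₁ ×ˢ E₂, ‖f₁ x‖₊ ∂(μ₁.prod μ₂)
          ≤ 2 * ENNReal.ofReal (Φ₁ (μ₁ E₁).toReal)) ∧
      (∀ E₁ E₂ : Set _, MeasurableSet E₁ → MeasurableSet E₂ →
        μ₁ E₁ < ∞ → μ₂ E₂ < ∞ →
        ∫⁻ x in E₁ ×ˢ E₂, ‖f₂ x‖₊ ∂(μ₁.prod μ₂)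
          ≤ 2 * ENNReal.ofReal (Φ₂ (μ₂ E₂).toReal)) := by
  obtain ⟨w, w0, wm, wi⟩ := exists_pos_lintegral_lt_of_sigmaFinite (μ₁.prod μ₂) one_ne_zero
  let ρ : Measure (Ω₁ × Ω₂) := (μ₁.prod μ₂).withDensity fun x => (w x : ℝ≥0∞)
  have : IsFiniteMeasure ρ := isFiniteMeasure_withDensity (wi.trans one_lt_top).ne
  let P := {p : Set Ω₁ × Set Ω₂ // MeasurableSet p.1 ∧ MeasurableSet p.2 ∧ μ₁ p.1 < ∞ ∧ μ₂ p.2 < ∞}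
  let v : P → Ω₁ × Ω₂ → ℝ≥0 := fun p => (p.1.1 ×ˢ p.1.2).indicator fun x => ‖f x‖₊ / w x
  have hv : ∀ p, Measurable (v p) := fun p => (hf.nnnorm.div wm).indicator (p.2.1.prod p.2.2.1)
  have conv : ∀ (u : Ω₁ × Ω₂ → ℝ) (_ : Measurable u) (p : P),
      ∫⁻ x, ENNReal.ofReal (u x) * v p x ∂ρ
        = ∫⁻ x in p.1.1 ×ˢ p.1.2, ENNReal.ofReal (u x) * ‖f x‖₊ ∂(μ₁.prod μ₂) := by
    intro u um p
    have mm : Measurable fun x => ENNReal.ofReal (u x) * (v p x : ℝ≥0∞) :=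
      um.ennreal_ofReal.mul (hv p).coe_nnreal_ennreal
    rw [lintegral_withDensity_eq_lintegral_mul _ wm.coe_nnreal_ennreal mm,
      ← lintegral_indicator (p.2.1.prod p.2.2.1)]
    refine lintegral_congr fun x => ?_
    by_cases hx : x ∈ p.1.1 ×ˢ p.1.2
    · simp only [Pi.mul_apply, v, Set.indicator_of_mem hx]
      rw [mul_left_comm, ← ENNReal.coe_mul, mul_div_cancel₀ _ (w0 x).ne']
    · simp only [Pi.mul_apply, v, Set.indicator_of_notMem hx]
      simp
  obtain ⟨h, hm, h0, h1, hh⟩ := select ρ v hv (fun p => ENNReal.ofReal (Φ₁ (μ₁ p.1.1).toReal))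
    (fun p => ENNReal.ofReal (Φ₂ (μ₂ p.1.2).toReal)) (by
      intro s ε hε
      obtain ⟨h, hm, h0, h1, hh⟩ := finiteStep μ₁ μ₂ Φ₁ Φ₂ hΦ₁concave hΦ₂concave hΦ₁mono hΦ₂mono
        hΦ₁nonneg hΦ₂nonneg hΦ₁zero hΦ₂zero f hf hbound (ι := s) (fun i => i.1.1.1) (fun i => i.1.1.2)
        (fun i => i.1.2.1) (fun i => i.1.2.2.1) (fun i => i.1.2.2.2.1) (fun i => i.1.2.2.2.2) ε hε
      refine ⟨h, hm, h0, h1, fun p hp => ?_⟩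
      rw [conv _ hm, conv (fun x => 1 - h x) (measurable_const.sub hm)]
      exact hh ⟨p, hp⟩)
  have nrm : ∀ (u y : ℝ), 0 ≤ u → ((‖u * y‖₊ : ℝ≥0) : ℝ≥0∞) = ENNReal.ofReal u * ‖y‖₊ := by
    intro u y hu
    rw [nnnorm_mul, ENNReal.coe_mul]
    congr 1
    rw [← enorm_eq_nnnorm, Real.enorm_of_nonneg hu]
  refine ⟨fun x => h x * f x, fun x => (1 - h x) * f x, hm.mul hf, (measurable_const.sub hm).mul hf,
    Filter.Eventually.of_forall fun x => ?_, ?_, ?_⟩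
  · simp only [Pi.add_apply]; ring
  · intro A B hA hB fA fB
    have := (hh ⟨(A, B), hA, hB, fA, fB⟩).1
    rw [conv _ hm] at this
    simp_rw [fun x => nrm (h x) (f x) (h0 x)]
    refine this.trans ?_
    rw [two_mul]; exact le_self_add
  · intro A B hA hB fA fB
    have := (hh ⟨(A, B), hA, hB, fA, fB⟩).2
    rw [conv (fun x => 1 - h x) (measurable_const.sub hm)] at this
    simp_rw [fun x => nrm (1 - h x) (f x) (by linarith [h1 x])]
    refine this.trans ?_
    rw [two_mul]; exact le_self_add
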